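/- Let α > -1 and 2λ > α+2. Then as r → 1⁻, ‖(1-rz²)^{-λ}‖²_α = (Γ(α+2)Γ(2λ-α-2)/(2^{α+1} Γ(λ)²)) · (1+o(1))/(1-r²)^{2λ-α-2}. -/

import Mathlib

open MeasureTheory Complex Real Filter

noncomputable def bergmanNormSq (α : ℝ) (φ : ℂ → ℂ) : ℝ :=
  (α + 1) / π * ∫ z in Metric.ball (0 : ℂ) 1, ‖φ z‖ ^ 2 * (1 - ‖z‖ ^ 2) ^ α


noncomputable def pp (s : ℝ) (n : ℕ) : ℝ := (∏ j ∈ Finset.range n, (s + j)) / (n.factorial : ℝ)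

lemma pp_pos {s : ℝ} (hs : 0 < s) (n : ℕ) : 0 < pp s n := by
  unfold pp
  have : 0 < ∏ j ∈ Finset.range n, (s + j) := Finset.prod_pos (fun j _ => by positivity)
  positivity

lemma choose_eq_pp (s : ℝ) (n : ℕ) : Ring.choose ((s:ℂ) + n - 1) n = (pp s n : ℂ) := by
  have h := Ring.factorial_nsmul_multichoose_eq_ascPochhammer (s : ℂ) n
  rw [Polynomial.ascPochhammer_smeval_eq_eval] at h
  have h2 : Polynomial.eval (s:ℂ) (ascPochhammer ℂ n) = ∏ j ∈ Finset.range n, ((s:ℂ) + j) := by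
    induction n with
    | zero => simp
    | succ n ih => 
      rw [ascPochhammer_succ_right, Finset.prod_range_succ, ← ih]
      · simp
      · rw [Ring.factorial_nsmul_multichoose_eq_ascPochhammer, Polynomial.ascPochhammer_smeval_eq_eval]
  rw [h2] at h
  have h3 : Ring.choose ((s:ℂ) + n - 1) n = Ring.multichoose (s:ℂ) n := by
    rw [Ring.choose]; congr 1; ring
  rw [h3]
  unfold pp
  push_cast
  rw [← h, nsmul_eq_mul]
  have hf : (n.factorial : ℂ) ≠ 0 := by exact_mod_cast n.factorial_ne_zero
  rw [mul_div_cancel_left₀ _ hf]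

lemma hasSum_pp (s : ℝ) {w : ℂ} (hw : ‖w‖ < 1) :
    HasSum (fun n => (pp s n : ℂ) * w ^ n) ((1 - w) ^ (-(s:ℂ))) := by
  have h := (Complex.one_div_one_sub_cpow_hasFPowerSeriesOnBall_zero (s:ℂ)).hasSum (y := w)
    (by rw [Metric.mem_eball, edist_zero_right, ← ofReal_norm, ENNReal.ofReal_lt_one]; exact hw)
  simp only [FormalMultilinearSeries.ofScalars_apply_eq, choose_eq_pp, zero_add, smul_eq_mul] at h
  rw [Complex.cpow_neg, ← one_div]
  exact h

lemma hasSum_pp_real (s : ℝ) {x : ℝ} (h0 : 0 ≤ x) (hx : x < 1) :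
    HasSum (fun n => pp s n * x ^ n) ((1 - x) ^ (-s)) := by
  have h := hasSum_pp s (w := (x:ℂ)) (by simpa [abs_of_nonneg h0] using hx)
  rw [← Complex.hasSum_ofReal]
  convert h using 1
  · ext n; push_cast; rfl
  · rw [Complex.ofReal_cpow (by linarith)]; push_cast; rfl

lemma gseq_eq {s : ℝ} (hs : 0 < s) (n : ℕ) : Real.GammaSeq s n = (n:ℝ) ^ s / (pp s n * (s + n)) := by
  have hp : ∏ j ∈ Finset.range n, (s + j) ≠ 0 := (Finset.prod_pos (fun j _ => by positivity)).ne'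
  have : s + n ≠ 0 := by positivity
  unfold Real.GammaSeq pp
  rw [Finset.prod_range_succ]
  field_simp

lemma pp_ratio (α lam : ℝ) (hα : -1 < α) (h : α + 2 < 2 * lam) :
    Tendsto (fun n => (pp lam n ^ 2 / pp (α + 2) (2 * n)) / pp (2 * lam - α - 2) n) atTop
     (nhds (Real.Gamma (α + 2) * Real.Gamma (2 * lam - α - 2) / (2 ^ (α + 1) * Real.Gamma lam ^ 2))) := by
  have hl : 0 < lam := by linarith
  have ha : 0 < α + 2 := by linarith
  have hs : 0 < 2 * lam - α - 2 := by linarith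
  set s := 2 * lam - α - 2 with hsdef
  have t1 := Real.GammaSeq_tendsto_Gamma lam
  have t2 := (Real.GammaSeq_tendsto_Gamma (α + 2)).comp (tendsto_id.const_mul_atTop' (r := 2) (by norm_num : (0:ℕ) < 2))
  have t3 := Real.GammaSeq_tendsto_Gamma s
  have inv : Tendsto (fun n : ℕ => ((n:ℝ))⁻¹) atTop (nhds 0) := tendsto_inv_atTop_nhds_zero_nat
  have t4 : Tendsto (fun n : ℕ => ((α+2) * (n:ℝ)⁻¹ + 2) * (s * (n:ℝ)⁻¹ + 1) / (lam * (n:ℝ)⁻¹ + 1)^2) atTop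
     (nhds (((α+2) * 0 + 2) * (s * 0 + 1) / (lam * 0 + 1)^2)) := by
    refine Tendsto.div (((inv.const_mul _).add_const _).mul ((inv.const_mul _).add_const _)) (((inv.const_mul _).add_const _).pow 2) (by norm_num)
  have t5 := (((t2.mul t3).div (t1.pow 2) (by have := Real.Gamma_pos_of_pos hl; positivity)).mul_const (2 ^ (α + 2))⁻¹).mul t4
  have e : Real.Gamma (α + 2) * Real.Gamma s / (2 ^ (α + 1) * Real.Gamma lam ^ 2) = 
    Real.Gamma (α + 2) * Real.Gamma s / Real.Gamma lam ^ 2 * (2 ^ (α + 2))⁻¹ * (((α+2) * 0 + 2) * (s * 0 + 1) / (lam * 0 + 1)^2) := by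
    have : (2:ℝ) ^ (α + 2) = 2 ^ (α+1) * 2 := by
      rw [← Real.rpow_add_one (by norm_num)]; congr 1; ring
    rw [this]
    have := Real.Gamma_pos_of_pos hl
    have := Real.rpow_pos_of_pos (show (0:ℝ) < 2 by norm_num) (α+1)
    field_simp
    ring
  rw [e]
  refine t5.congr' ?_
  filter_upwards [eventually_gt_atTop 0] with n hn
  have hn' : (0:ℝ) < n := by exact_mod_cast hn
  simp only [Pi.div_apply, Function.comp, id, gseq_eq hl, gseq_eq ha, gseq_eq hs]
  have p1 := pp_pos hl n
  have p2 := pp_pos ha (2*n)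
  have p3 := pp_pos hs n
  have q1 := Real.rpow_pos_of_pos hn' lam
  have q2 := Real.rpow_pos_of_pos hn' (α+2)
  have q3 := Real.rpow_pos_of_pos (show (0:ℝ) < 2 by norm_num) (α+2)
  have e1 : ((2 * n : ℕ):ℝ) ^ (α+2) = 2 ^ (α+2) * (n:ℝ) ^ (α+2) := by
    push_cast; rw [Real.mul_rpow (by norm_num) hn'.le]
  have e2 : (n:ℝ) ^ s = ((n:ℝ) ^ lam)^2 / (n:ℝ)^(α+2) := by
    rw [← Real.rpow_mul_natCast hn'.le, ← Real.rpow_sub hn']; congr 1; rw [hsdef]; push_cast; ring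
  rw [e1, e2]
  push_cast
  have : α + 2 + 2 * n ≠ 0 := by positivity
  have : lam + n ≠ 0 := by positivity
  have : s + n ≠ 0 := by positivity
  have : lam * (n:ℝ)⁻¹ + 1 ≠ 0 := by positivity
  have : (lam * (n:ℝ)⁻¹ + 1) = (lam + n)/n := by field_simp
  rw [this]
  have : ((α+2) * (n:ℝ)⁻¹ + 2) = (α + 2 + 2 * n)/n := by field_simp
  rw [this]
  have : (s * (n:ℝ)⁻¹ + 1) = (s + n)/n := by field_simp
  rw [this]
  field_simp

lemma abel_ratio (c d : ℕ → ℝ) (s L : ℝ) (hs : 0 < s) (hd : ∀ n, 0 < d n)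
    (hsum : ∀ x : ℝ, 0 ≤ x → x < 1 → HasSum (fun n => d n * x ^ n) ((1 - x) ^ (-s)))
    (hcd : Tendsto (fun n => c n / d n) atTop (nhds L)) :
    Tendsto (fun x : ℝ => (1 - x) ^ s * ∑' n, c n * x ^ n) (nhdsWithin 1 (Set.Ioo (0:ℝ) 1)) (nhds L) := by
  rw [Metric.tendsto_nhds]
  intro ε hε
  obtain ⟨N, hN⟩ := eventually_atTop.1 (Metric.tendsto_nhds.1 hcd (ε/2) (by positivity))
  set K := ∑ n ∈ Finset.range N, |c n - L * d n| with hK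
  have hG : Tendsto (fun x : ℝ => (1 - x) ^ s * K) (nhdsWithin 1 (Set.Ioo (0:ℝ) 1)) (nhds 0) := by
    have : ContinuousAt (fun x : ℝ => (1 - x) ^ s * K) 1 := by
      apply ContinuousAt.mul _ continuousAt_const
      exact (continuousAt_const.sub continuousAt_id).rpow_const (Or.inr hs.le)
    have h2 := this.tendsto
    simp [Real.zero_rpow hs.ne'] at h2
    exact h2.mono_left nhdsWithin_le_nhds
  filter_upwards [hG.eventually_lt_const (show (0:ℝ) < ε/2 by positivity), self_mem_nhdsWithin] with x hx hxm
  obtain ⟨hx0, hx1⟩ := hxm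
  have hD := hsum x hx0.le hx1
  have hpos : 0 < (1 - x) ^ s := Real.rpow_pos_of_pos (by linarith) _
  have hinv : (1 - x) ^ s * (1-x) ^ (-s) = 1 := by
    rw [← Real.rpow_add (by linarith)]; simp
  have hE : HasSum (fun n => if n < N then |c n - L * d n| else 0) K := by
    have := hasSum_sum_of_ne_finset_zero (L := SummationFilter.unconditional ℕ) (f := fun n => if n < N then |c n - L * d n| else 0) (s := Finset.range N)
      (by intro b hb; simp at hb; simp; omega)
    convert this using 1
    rw [hK]; apply Finset.sum_congr rfl; intro n hn; simp at hn; simp [hn]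
  have hB := hE.add (hD.mul_left (ε/2))
  have hbd : ∀ n, ‖(c n - L * d n) * x ^ n‖ ≤ (if n < N then |c n - L * d n| else 0) + ε/2 * (d n * x ^ n) := by
    intro n
    have hxn : 0 < x ^ n := by positivity
    have hxn1 : x ^ n ≤ 1 := pow_le_one₀ hx0.le hx1.le
    rw [norm_mul, Real.norm_eq_abs, Real.norm_eq_abs, abs_of_pos hxn]
    have hdn := hd n
    split_ifs with hn
    · have : |c n - L * d n| * x ^ n ≤ |c n - L * d n| := mul_le_of_le_one_right (abs_nonneg _) hxn1
      have : 0 < ε/2 * (d n * x ^ n) := by positivity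
      linarith
    · have h1 := hN n (by omega)
      rw [Real.dist_eq] at h1
      have : |c n - L * d n| = |c n / d n - L| * d n := by
        rw [← abs_of_pos hdn, ← abs_mul, abs_of_pos hdn]; congr 1; field_simp
      rw [this, zero_add, mul_assoc]
      gcongr
  have hS : Summable (fun n => (c n - L * d n) * x ^ n) := Summable.of_norm_bounded hB.summable hbd
  have hT := hS.hasSum
  have hle : ‖∑' n, (c n - L * d n) * x ^ n‖ ≤ K + ε/2 * (1-x)^(-s) :=
    tsum_of_norm_bounded hB hbd
  have hc : ∑' n, c n * x ^ n = ∑' n, (c n - L * d n) * x ^ n + L * (1-x)^(-s) := by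
    rw [← (hT.add (hD.mul_left L)).tsum_eq]
    congr 1; ext n; ring
  rw [hc, Real.dist_eq, mul_add]
  have : (1-x)^s * (L * (1-x)^(-s)) = L := by rw [mul_left_comm, hinv, mul_one]
  rw [this, add_sub_cancel_right, abs_mul, abs_of_pos hpos]
  calc _ ≤ (1-x)^s * (K + ε/2 * (1-x)^(-s)) := by gcongr; exact hle
    _ = (1-x)^s * K + ε/2 * ((1-x)^s * (1-x)^(-s)) := by ring
    _ < ε := by rw [hinv]; linarith
lemma gamma_add_nat {s : ℝ} (hs : 0 < s) (m : ℕ) :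
    Real.Gamma (s + m) = (∏ j ∈ Finset.range m, (s + j)) * Real.Gamma s := by
  induction m with
  | zero => simp
  | succ m ih =>
    have : s + (m + 1 : ℕ) = (s + m) + 1 := by push_cast; ring
    rw [this, Real.Gamma_add_one (by positivity), ih, Finset.prod_range_succ]
    ring

lemma beta_pp (α : ℝ) (hα : -1 < α) (m : ℕ) :
    ProbabilityTheory.beta (m + 1) (α + 1) = ((α + 1) * pp (α + 2) m)⁻¹ := by
  have h1 : 0 < α + 1 := by linarith
  have h2 : 0 < α + 2 := by linarith
  have e : (m:ℝ) + 1 + (α + 1) = (α + 2) + m := by ring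
  have e2 : α + 2 = (α + 1) + 1 := by ring
  have g := Real.Gamma_pos_of_pos h1
  have hp : 0 < ∏ j ∈ Finset.range m, (α + 2 + j) := Finset.prod_pos (fun j _ => by positivity)
  have e3 : Real.Gamma (α + 2) = (α + 1) * Real.Gamma (α + 1) := by
    rw [e2, Real.Gamma_add_one h1.ne']
  rw [ProbabilityTheory.beta, e, gamma_add_nat h2, Real.Gamma_nat_eq_factorial, pp, e3]
  field_simp

lemma lint_beta (α : ℝ) (hα : -1 < α) (m : ℕ) :
    ∫⁻ u in Set.Ioo (0:ℝ) 1, ENNReal.ofReal (u ^ m * (1 - u) ^ α) =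
      ENNReal.ofReal (((α + 1) * pp (α + 2) m)⁻¹) := by
  have h1 : 0 < α + 1 := by linarith
  have hm : (0:ℝ) < m + 1 := by positivity
  have h := ProbabilityTheory.lintegral_betaPDF_eq_one hm h1
  have hb := ProbabilityTheory.beta_pos hm h1
  rw [ProbabilityTheory.lintegral_betaPDF] at h
  have : ∀ x : ℝ, ENNReal.ofReal (1 / ProbabilityTheory.beta (m+1) (α+1) * x ^ ((m:ℝ) + 1 - 1) * (1 - x) ^ (α + 1 - 1))
     = ENNReal.ofReal (1 / ProbabilityTheory.beta (m+1) (α+1)) * ENNReal.ofReal (x ^ m * (1 - x) ^ α) := by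
    intro x
    rw [← ENNReal.ofReal_mul (by positivity)]
    simp [mul_assoc]
  simp_rw [this] at h
  rw [lintegral_const_mul _ (by fun_prop)] at h
  rw [← beta_pp α hα]
  calc _ = ENNReal.ofReal (ProbabilityTheory.beta (m+1) (α+1)) * (ENNReal.ofReal (1 / ProbabilityTheory.beta (m+1) (α+1)) * ∫⁻ u in Set.Ioo (0:ℝ) 1, ENNReal.ofReal (u ^ m * (1 - u) ^ α)) := by
        rw [← mul_assoc, ← ENNReal.ofReal_mul hb.le]
        field_simp
        simp
    _ = _ := by rw [h, mul_one]

lemma lint_moment (α : ℝ) (hα : -1 < α) (m : ℕ) :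
    ∫⁻ ρ in Set.Ioo (0:ℝ) 1, ENNReal.ofReal (ρ * (ρ ^ (2 * m) * (1 - ρ ^ 2) ^ α)) =
      ENNReal.ofReal ((2 * ((α + 1) * pp (α + 2) m))⁻¹) := by
  have himg : (fun x : ℝ => x ^ 2) '' Set.Ioo (0:ℝ) 1 = Set.Ioo 0 1 := by
    ext y; constructor
    · rintro ⟨x, ⟨h0, h1⟩, rfl⟩
      exact ⟨by positivity, by simp only; nlinarith⟩
    · rintro ⟨h0, h1⟩
      refine ⟨√y, ⟨Real.sqrt_pos.2 h0, ?_⟩, Real.sq_sqrt h0.le⟩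
      rw [Real.sqrt_lt' one_pos]; simpa using h1
  have h := lintegral_image_eq_lintegral_abs_deriv_mul (s := Set.Ioo (0:ℝ) 1) (f := fun x : ℝ => x ^ 2)
    (f' := fun x => 2 * x) measurableSet_Ioo
    (fun x _ => by simpa using (hasDerivAt_pow 2 x).hasDerivWithinAt)
    (fun x hx y hy hxy => by
      simp only at hxy
      exact (pow_left_inj₀ hx.1.le hy.1.le two_ne_zero).1 hxy)
    (fun u => ENNReal.ofReal (u ^ m * (1 - u) ^ α))
  rw [himg, lint_beta α hα] at h
  have h2 : ∫⁻ x in Set.Ioo (0:ℝ) 1, ENNReal.ofReal |2 * x| * ENNReal.ofReal ((x^2) ^ m * (1 - x^2) ^ α) = 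
     ENNReal.ofReal 2 * ∫⁻ ρ in Set.Ioo (0:ℝ) 1, ENNReal.ofReal (ρ * (ρ ^ (2 * m) * (1 - ρ ^ 2) ^ α)) := by
    rw [← lintegral_const_mul _ (by fun_prop)]
    apply setLIntegral_congr_fun measurableSet_Ioo
    intro x hx
    have := hx.1
    simp only
    rw [abs_of_pos (by linarith), ← ENNReal.ofReal_mul (by linarith), ← ENNReal.ofReal_mul (by norm_num), ← pow_mul]
    ring_nf
  rw [h2] at h
  calc _ = ENNReal.ofReal (1/2) * (ENNReal.ofReal 2 * ∫⁻ ρ in Set.Ioo (0:ℝ) 1, ENNReal.ofReal (ρ * (ρ ^ (2 * m) * (1 - ρ ^ 2) ^ α))) := by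
        rw [← mul_assoc, ← ENNReal.ofReal_mul (by norm_num)]
        norm_num
    _ = _ := by
        rw [← h, ← ENNReal.ofReal_mul (by norm_num)]
        congr 1
        rw [mul_inv]; norm_num; ring

lemma exp_orth (n m : ℕ) :
    ∫ θ in (-π)..π, Complex.exp (2 * n * θ * I) * Complex.exp (-(2 * m * θ * I)) = if n = m then (2 * π : ℂ) else 0 := by
  split_ifs with h
  · subst h
    simp [← Complex.exp_add]
    ring
  · have hc : (2 * ((n:ℂ) - m) * I) ≠ 0 := by
      have : (n:ℂ) - m ≠ 0 := sub_ne_zero.2 (by exact_mod_cast h)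
      simp [this]
    have := integral_exp_mul_complex (a := -π) (b := π) hc
    have e : ∀ θ : ℝ, Complex.exp (2 * n * θ * I) * Complex.exp (-(2 * m * θ * I)) = Complex.exp (2 * ((n:ℂ) - m) * I * θ) := by
      intro θ
      rw [← Complex.exp_add]; congr 1; ring
    simp_rw [e]
    rw [this, div_eq_zero_iff]
    left
    rw [sub_eq_zero, Complex.exp_eq_exp_iff_exists_int]
    refine ⟨2 * ((n:ℤ) - m), ?_⟩
    push_cast; ring

lemma parseval (c : ℕ → ℝ) (hc : Summable (fun n => |c n|)) (g : ℝ → ℂ)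
    (hg : ∀ θ : ℝ, HasSum (fun n => (c n : ℂ) * Complex.exp (2 * n * θ * I)) (g θ)) :
    ∫ θ in (-π)..π, ‖g θ‖ ^ 2 = 2 * π * ∑' n, c n ^ 2 := by
  have nrm : ∀ (n : ℕ) (θ : ℝ), ‖Complex.exp (2 * n * θ * I)‖ = 1 := by
    intro n θ
    have := Complex.norm_exp_ofReal_mul_I (2 * n * θ)
    push_cast at this; exact this
  have nrm' : ∀ (n : ℕ) (θ : ℝ), ‖Complex.exp (-(2 * n * θ * I))‖ = 1 := by
    intro n θ
    have := Complex.norm_exp_ofReal_mul_I (-(2 * n * θ))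
    push_cast at this; rw [neg_mul] at this; exact this
  have hconj : ∀ θ : ℝ, HasSum (fun n => (c n : ℂ) * Complex.exp (-(2 * n * θ * I))) (starRingEnd ℂ (g θ)) := by
    intro θ
    convert (hg θ).map (starRingEnd ℂ) Complex.continuous_conj using 2 with n
    simp only [Function.comp]
    rw [map_mul, Complex.conj_ofReal, ← Complex.exp_conj]
    simp [show (starRingEnd ℂ) 2 = 2 from Complex.conj_ofNat 2]
  let F : ℕ × ℕ → ℝ → ℂ := fun p θ => ((c p.1 : ℂ) * Complex.exp (2 * p.1 * θ * I)) * ((c p.2 : ℂ) * Complex.exp (-(2 * p.2 * θ * I)))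
  have hF : ∀ θ, HasSum (fun p => F p θ) ((‖g θ‖^2 : ℝ) : ℂ) := by
    intro θ
    have e : ((‖g θ‖^2 : ℝ) : ℂ) = g θ * starRingEnd ℂ (g θ) := by
      rw [Complex.mul_conj, Complex.normSq_eq_norm_sq]
    rw [e]
    have h1 : Summable (fun n => ‖(c n : ℂ) * Complex.exp (2 * n * θ * I)‖) := by
      refine hc.congr (fun n => ?_)
      rw [norm_mul, nrm, mul_one, Complex.norm_real, Real.norm_eq_abs]
    have h2 : Summable (fun n => ‖(c n : ℂ) * Complex.exp (-(2 * n * θ * I))‖) := by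
      refine hc.congr (fun n => ?_)
      rw [norm_mul, nrm', mul_one, Complex.norm_real, Real.norm_eq_abs]
    have h3 := summable_mul_of_summable_norm h1 h2
    have h4 := tsum_mul_tsum_of_summable_norm h1 h2
    rw [(hg θ).tsum_eq, (hconj θ).tsum_eq] at h4
    rw [h4]
    exact h3.hasSum
  have hsum : Summable (fun p : ℕ × ℕ => |c p.1| * |c p.2|) := hc.mul_of_nonneg hc (fun _ => abs_nonneg _) (fun _ => abs_nonneg _)
  have hI := intervalIntegral.hasSum_integral_of_dominated_convergence (a := -π) (b := π) (μ := volume) (F := F) (f := fun θ => ((‖g θ‖^2 : ℝ) : ℂ))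
    (fun p _ => |c p.1| * |c p.2|)
    (fun p => by apply Continuous.aestronglyMeasurable; fun_prop)
    (fun p => by
      filter_upwards with θ _
      simp [F, nrm, nrm'])
    (by filter_upwards with θ _; exact hsum)
    (by simp)
    (by filter_upwards with θ _; exact hF θ)
  have hFint : ∀ p : ℕ × ℕ, ∫ θ in (-π)..π, F p θ = if p.1 = p.2 then ((2 * π * c p.1 ^ 2 : ℝ) : ℂ) else 0 := by
    intro p
    have : ∀ θ : ℝ, F p θ = (c p.1 * c p.2 : ℂ) * (Complex.exp (2 * p.1 * θ * I) * Complex.exp (-(2 * p.2 * θ * I))) := by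
      intro θ; simp only [F]; ring
    simp_rw [this]
    rw [intervalIntegral.integral_const_mul, exp_orth]
    split_ifs with h
    · rw [h]; push_cast; ring
    · simp
  simp_rw [hFint] at hI
  rw [intervalIntegral.integral_ofReal] at hI
  have hd : HasSum (fun n : ℕ => ((2 * π * c n ^ 2 : ℝ) : ℂ)) ((∫ θ in (-π)..π, ‖g θ‖ ^ 2 : ℝ) : ℂ) := by
    have inj : Function.Injective (fun n : ℕ => (n, n)) := fun a b h => (Prod.ext_iff.1 h).1
    rw [← inj.hasSum_iff] at hI
    · have e : (fun n : ℕ => ((2 * π * c n ^ 2 : ℝ) : ℂ)) = (fun p : ℕ × ℕ => if p.1 = p.2 then ((2 * π * c p.1 ^ 2 : ℝ) : ℂ) else 0) ∘ (fun n : ℕ => (n, n)) := by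
        ext n; simp
      rw [e]
      exact hI
    · rintro ⟨a, b⟩ hx
      have : a ≠ b := by rintro rfl; exact hx ⟨a, rfl⟩
      simp [this]
  rw [Complex.hasSum_ofReal] at hd
  rw [← hd.tsum_eq, tsum_mul_left]
lemma norm_series (α lam r : ℝ) (hα : -1 < α) (hl : 0 < lam) (hr : r ∈ Set.Ioo (0:ℝ) 1) :
    bergmanNormSq α (fun z : ℂ => (1 - (r : ℂ) * z ^ 2) ^ (-(lam : ℂ))) =
      ∑' n, (pp lam n ^ 2 / pp (α + 2) (2 * n)) * (r ^ 2) ^ n := by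
  obtain ⟨hr0, hr1⟩ := hr
  have ha : 0 < α + 1 := by linarith
  have ha2 : 0 < α + 2 := by linarith
  set φ : ℂ → ℂ := fun z : ℂ => (1 - (r : ℂ) * z ^ 2) ^ (-(lam : ℂ)) with hφ
  have hφm : Measurable φ := by
    rw [hφ]; fun_prop
  -- angular integral
  have hang : ∀ ρ ∈ Set.Ioo (0:ℝ) 1, ∫⁻ θ in Set.Ioo (-π) π, ENNReal.ofReal (‖φ (ρ * Complex.exp (θ * I))‖ ^ 2) =
      ∑' n, ENNReal.ofReal (2 * π * (pp lam n ^ 2 * (r ^ 2) ^ n * ρ ^ (2 * (2 * n)))) := by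
    rintro ρ ⟨h0, h1⟩
    have hx1 : r * ρ ^ 2 < 1 := by
      have : ρ ^ 2 < 1 := by nlinarith
      nlinarith [sq_nonneg ρ]
    have hx0 : 0 ≤ r * ρ ^ 2 := by positivity
    have hs := hasSum_pp_real lam hx0 hx1
    have hnn : ∀ n, 0 ≤ pp lam n * (r * ρ ^ 2) ^ n := fun n => mul_nonneg (pp_pos hl n).le (by positivity)
    have habs : Summable (fun n => |pp lam n * (r * ρ ^ 2) ^ n|) := by
      simpa only [abs_of_nonneg (hnn _)] using hs.summable
    have hP := parseval (fun n => pp lam n * (r * ρ ^ 2) ^ n) habs (fun θ => φ (ρ * Complex.exp (θ * I))) (by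
      intro θ
      have hw : ‖(r:ℂ) * (ρ * Complex.exp (θ * I)) ^ 2‖ < 1 := by
        rw [norm_mul, norm_pow, norm_mul, Complex.norm_exp_ofReal_mul_I]
        simpa [abs_of_pos hr0] using hx1
      have := hasSum_pp lam hw
      convert this using 2 with n
      push_cast
      rw [mul_assoc, mul_pow (ρ:ℂ), ← mul_assoc (r:ℂ), mul_pow _ (Complex.exp (θ * I) ^ 2), ← pow_mul, ← Complex.exp_nat_mul]
      congr 3
      push_cast; ring)
    have hsq : Summable (fun n => (pp lam n * (r * ρ ^ 2) ^ n) ^ 2) := by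
      have hb := hs.summable.tendsto_atTop_zero.eventually_le_const (show (0:ℝ) < 1 by norm_num)
      refine Summable.of_norm_bounded_eventually_nat hs.summable ?_
      filter_upwards [hb] with n hn
      rw [Real.norm_eq_abs, abs_of_nonneg (by positivity)]
      nlinarith [hnn n]
    have hcont : Continuous (fun θ : ℝ => φ (ρ * Complex.exp (θ * I))) := by
      rw [hφ]
      refine Continuous.cpow (by fun_prop) (by fun_prop) ?_
      intro θ
      have hw : ‖(r:ℂ) * (ρ * Complex.exp (θ * I)) ^ 2‖ < 1 := by
        rw [norm_mul, norm_pow, norm_mul, Complex.norm_exp_ofReal_mul_I]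
        simpa [abs_of_pos hr0] using hx1
      left
      have := (Complex.abs_re_le_norm _).trans_lt hw
      have := (abs_lt.1 this).2
      simp only [Complex.sub_re, Complex.one_re]
      linarith
    rw [← ofReal_integral_eq_lintegral_ofReal, ← integral_Ioc_eq_integral_Ioo, ← intervalIntegral.integral_of_le (by linarith [Real.pi_pos]), hP,
      ← tsum_mul_left, ENNReal.ofReal_tsum_of_nonneg (fun n => by positivity) (hsq.mul_left _)]
    · congr 1; ext n; congr 1
      ring
    · have : IntegrableOn (fun θ : ℝ => ‖φ (ρ * Complex.exp (θ * I))‖ ^ 2) (Set.Icc (-π) π) :=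
        (hcont.norm.pow 2).continuousOn.integrableOn_compact isCompact_Icc
      exact this.mono_set Set.Ioo_subset_Icc_self
    · filter_upwards with θ; positivity
  -- lintegral
  have hL : ∫⁻ z in Metric.ball (0:ℂ) 1, ENNReal.ofReal (‖φ z‖ ^ 2 * (1 - ‖z‖ ^ 2) ^ α) =
      ∑' n, ENNReal.ofReal (π / (α + 1) * ((pp lam n ^ 2 / pp (α + 2) (2 * n)) * (r ^ 2) ^ n)) := by
    rw [← lintegral_indicator measurableSet_ball, ← Complex.lintegral_comp_polarCoord_symm]
    set G : ℂ → ENNReal := (Metric.ball (0:ℂ) 1).indicator (fun z => ENNReal.ofReal (‖φ z‖ ^ 2 * (1 - ‖z‖ ^ 2) ^ α)) with hG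
    have hGm : Measurable G := Measurable.indicator (by fun_prop) measurableSet_ball
    have hpc : ∀ p : ℝ × ℝ, Complex.polarCoord.symm p = p.1 * Complex.exp (p.2 * I) := by
      intro p; rw [Complex.polarCoord_symm_apply, Complex.exp_mul_I]; simp
    simp_rw [hpc, smul_eq_mul]
    rw [show polarCoord.target = Set.Ioi (0 : ℝ) ×ˢ Set.Ioo (-π) π from rfl, Measure.volume_eq_prod, setLIntegral_prod _ (by fun_prop)]
    have hin : ∀ ρ ∈ Set.Ioi (0:ℝ), ∫⁻ θ in Set.Ioo (-π) π, ENNReal.ofReal ρ * G (ρ * Complex.exp (θ * I)) =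
       (Set.Ioo (0:ℝ) 1).indicator (fun ρ => ∑' n, ENNReal.ofReal (2 * π * (pp lam n ^ 2 * (r ^ 2) ^ n)) * ENNReal.ofReal (ρ * (ρ ^ (2 * (2 * n)) * (1 - ρ ^ 2) ^ α))) ρ := by
      intro ρ hρ
      have hρ0 : 0 < ρ := hρ
      have hn : ∀ θ : ℝ, ‖(ρ:ℂ) * Complex.exp (θ * I)‖ = ρ := by
        intro θ
        rw [norm_mul, Complex.norm_exp_ofReal_mul_I]; simp [abs_of_pos hρ0]
      by_cases h1 : ρ < 1
      · rw [Set.indicator_of_mem (show ρ ∈ Set.Ioo (0:ℝ) 1 from ⟨hρ0, h1⟩)]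
        have hq : 0 ≤ (1 - ρ ^ 2) ^ α := Real.rpow_nonneg (by nlinarith) _
        have : ∀ θ : ℝ, ENNReal.ofReal ρ * G (ρ * Complex.exp (θ * I)) = ENNReal.ofReal (ρ * (1 - ρ ^ 2) ^ α) * ENNReal.ofReal (‖φ (ρ * Complex.exp (θ * I))‖ ^ 2) := by
          intro θ
          rw [hG, Set.indicator_of_mem (by rw [mem_ball_zero_iff, hn]; exact h1), hn, ← ENNReal.ofReal_mul hρ0.le, ← ENNReal.ofReal_mul (by positivity)]
          congr 1; ring
        simp_rw [this]
        rw [lintegral_const_mul _ (by fun_prop), hang ρ ⟨hρ0, h1⟩, ← ENNReal.tsum_mul_left]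
        congr 1; ext n
        rw [← ENNReal.ofReal_mul (by positivity), ← ENNReal.ofReal_mul (by positivity)]
        congr 1; ring
      · rw [Set.indicator_of_notMem (by simp [h1])]
        have : ∀ θ : ℝ, G (ρ * Complex.exp (θ * I)) = 0 := by
          intro θ
          rw [hG, Set.indicator_of_notMem (by rw [mem_ball_zero_iff, hn]; exact h1)]
        simp [this]
    rw [setLIntegral_congr_fun measurableSet_Ioi hin, setLIntegral_indicator measurableSet_Ioo,
      Set.inter_eq_left.2 (fun x hx => hx.1), lintegral_tsum (fun n => by fun_prop)]
    congr 1; ext n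
    rw [lintegral_const_mul _ (by fun_prop), lint_moment α hα, ← ENNReal.ofReal_mul (by positivity)]
    congr 1
    have := pp_pos ha2 (2 * n)
    field_simp
  have hnn : ∀ n, 0 ≤ π / (α + 1) * ((pp lam n ^ 2 / pp (α + 2) (2 * n)) * (r ^ 2) ^ n) := by
    intro n
    have := pp_pos ha2 (2 * n)
    positivity
  unfold bergmanNormSq
  rw [integral_eq_lintegral_of_nonneg_ae, hL, ENNReal.tsum_toReal_eq (fun n => ENNReal.ofReal_ne_top)]
  · simp_rw [ENNReal.toReal_ofReal (hnn _)]
    rw [tsum_mul_left, ← mul_assoc]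
    have : (α + 1) / π * (π / (α + 1)) = 1 := by have := Real.pi_pos; field_simp
    rw [this, one_mul]
  · refine ae_restrict_of_forall_mem measurableSet_ball (fun z hz => ?_)
    have hz : ‖z‖ < 1 := by simpa using hz
    have : 0 ≤ (1 - ‖z‖ ^ 2) ^ α := Real.rpow_nonneg (by nlinarith [norm_nonneg z]) _
    simp only [Pi.zero_apply]
    positivity
  · exact Measurable.aestronglyMeasurable (by fun_prop)

theorem bergman_norm_asymptotic_sq (α lam : ℝ) (hα : -1 < α) (h : α + 2 < 2 * lam) :
    Tendsto
      (fun r : ℝ =>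
        (1 - r ^ 2) ^ (2 * lam - α - 2) *
          bergmanNormSq α (fun z : ℂ => (1 - (r : ℂ) * z ^ 2) ^ (-(lam : ℂ))))
      (nhdsWithin 1 (Set.Ioo (0 : ℝ) 1))
      (nhds (Real.Gamma (α + 2) * Real.Gamma (2 * lam - α - 2) / (2 ^ (α + 1) * Real.Gamma lam ^ 2))) := by
  have hs : 0 < 2 * lam - α - 2 := by linarith
  have hA := abel_ratio (fun n => pp lam n ^ 2 / pp (α + 2) (2 * n)) (pp (2 * lam - α - 2)) _ _ hs
    (pp_pos hs) (fun x h0 h1 => hasSum_pp_real _ h0 h1) (pp_ratio α lam hα h)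
  have ht : Tendsto (fun r : ℝ => r ^ 2) (nhdsWithin 1 (Set.Ioo (0 : ℝ) 1)) (nhdsWithin 1 (Set.Ioo (0 : ℝ) 1)) := by
    apply tendsto_nhdsWithin_of_tendsto_nhds_of_eventually_within
    · have : ContinuousAt (fun r : ℝ => r ^ 2) 1 := by fun_prop
      have h2 := this.tendsto
      simp only [one_pow] at h2
      exact h2.mono_left nhdsWithin_le_nhds
    · filter_upwards [self_mem_nhdsWithin] with r hr
      obtain ⟨h0, h1⟩ := hr
      exact ⟨by positivity, by nlinarith⟩
  refine (hA.comp ht).congr' ?_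
  filter_upwards [self_mem_nhdsWithin] with r hr
  rw [norm_series α lam r hα (by linarith) hr]
  rfl
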